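/- arXiv:1906.08572 — 4 statements merged into one kernel-verified Lean document; each statement's English description precedes it below -/
import Mathlib

section
/- Let D, R ∈ ℝ^{p×p} be symmetric positive semidefinite and q ≤ p. Then there exists a matrix E ∈ ℂ^{(p−q)×q} and a matrix Γ ∈ ℂ^{q×q} such that (D + jR)·[I_q; E] = [Γ; 0] (i.e., the Schur complement of D + jR with respect to the first q indices exists). -/
namespace Matrix

open scoped ComplexOrder in
/-- A real positive semidefinite matrix is positive semidefinite over `ℂ`. -/
theorem PosSemidef.map_ofReal {n : Type*} [Fintype n] {A : Matrix n n ℝ}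
    (hA : A.PosSemidef) : (A.map Complex.ofReal).PosSemidef := by
  classical
  open scoped MatrixOrder in
  obtain ⟨B, rfl⟩ := CStarAlgebra.nonneg_iff_eq_star_mul_self.mp hA.nonneg
  have h : (star B * B).map Complex.ofReal =
      (B.map Complex.ofReal)ᴴ * B.map Complex.ofReal := by
    ext i j
    simp [mul_apply, star_eq_conjTranspose]
  rw [h]
  exact posSemidef_conjTranspose_mul_self _

open scoped ComplexOrder in
/-- If the quadratic form of `A + iB` vanishes at a vector, with `A` and `B` positive
semidefinite, then the vector lies in the left kernel of `A + iB`. -/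
theorem PosSemidef.vecMul_add_I_smul_eq_zero {n : Type*} [Fintype n] {A B : Matrix n n ℂ}
    (hA : A.PosSemidef) (hB : B.PosSemidef) {u : n → ℂ}
    (hu : u ᵥ* (A + Complex.I • B) ⬝ᵥ star u = 0) : u ᵥ* (A + Complex.I • B) = 0 := by
  have vecMul_eq_zero {C : Matrix n n ℂ} (hC : C.PosSemidef)
      (h : star (star u) ⬝ᵥ C *ᵥ star u = 0) : u ᵥ* C = 0 := by
    have h' := congrArg star ((hC.dotProduct_mulVec_zero_iff _).mp h)
    rwa [star_mulVec, hC.isHermitian.eq, star_star, star_zero] at h'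
  have ha := Complex.nonneg_iff.mp (hA.dotProduct_mulVec_nonneg (star u))
  have hb := Complex.nonneg_iff.mp (hB.dotProduct_mulVec_nonneg (star u))
  rw [← dotProduct_mulVec, add_mulVec, smul_mulVec, dotProduct_add, dotProduct_smul,
    ← star_star u, star_star (star u)] at hu
  have hre := congrArg Complex.re hu
  have him := congrArg Complex.im hu
  simp only [smul_eq_mul, Complex.add_re, Complex.add_im, Complex.mul_re, Complex.mul_im,
    Complex.I_re, Complex.I_im, Complex.zero_re, Complex.zero_im, ← ha.2, ← hb.2] at hre him
  rw [vecMul_add, vecMul_smul, vecMul_eq_zero hA, vecMul_eq_zero hB, smul_zero, add_zero]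
  · exact Complex.ext (by simpa using him) hb.2.symm
  · exact Complex.ext (by simpa using hre) ha.2.symm

/-- The linear system `M x = v` is solvable if every vector in the left kernel of `M`
annihilates `v`. -/
theorem exists_mulVec_eq_of_forall_vecMul_eq_zero {K m n : Type*} [Field K] [Fintype m]
    [Fintype n] (M : Matrix m n K) (v : m → K)
    (h : ∀ y : m → K, y ᵥ* M = 0 → y ⬝ᵥ v = 0) : ∃ x : n → K, M *ᵥ x = v := by
  classical
  by_contra! hv
  have hmem : v ∉ LinearMap.range M.mulVecLin := fun ⟨x, hx⟩ ↦ hv x hx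
  obtain ⟨f, hfv, hf⟩ := Submodule.exists_le_ker_of_notMem hmem
  obtain ⟨y, rfl⟩ := (dotProductEquiv K m).surjective f
  refine hfv (h y (dotProduct_eq_zero _ fun x ↦ ?_))
  rw [← dotProduct_mulVec]
  exact hf ⟨x, rfl⟩

/-- The matrix equation `M X = N` is solvable if the left kernel of `M` is contained in that
of `N`. -/
theorem exists_mul_eq_of_forall_vecMul_eq_zero {K l m n : Type*} [Field K] [Fintype m]
    [Fintype n] (M : Matrix m n K) (N : Matrix m l K)
    (h : ∀ y : m → K, y ᵥ* M = 0 → y ᵥ* N = 0) : ∃ X : Matrix n l K, M * X = N := by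
  choose x hx using fun j ↦ M.exists_mulVec_eq_of_forall_vecMul_eq_zero (N.col j)
    fun y hy ↦ congrFun (h y hy) j
  exact ⟨of fun i j ↦ x j i, ext fun i j ↦ congrFun (hx j) i⟩

end Matrix


open Matrix in
theorem schur_complement_exists
    (q r : ℕ)
    (D R : Matrix (Fin q ⊕ Fin r) (Fin q ⊕ Fin r) ℝ)
    (hD : D.PosSemidef) (hR : R.PosSemidef) :
    ∃ (E : Matrix (Fin r) (Fin q) ℂ) (Γ : Matrix (Fin q) (Fin q) ℂ),
      (D.map Complex.ofReal + Complex.I • R.map Complex.ofReal) *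
          Matrix.fromBlocks 1 0 E 0 =
        Matrix.fromBlocks Γ 0 0 0 := by
  set X := D.map Complex.ofReal + Complex.I • R.map Complex.ofReal with hX
  have hker (y : Fin r → ℂ) (hy : y ᵥ* X.toBlocks₂₂ = 0) : y ᵥ* X.toBlocks₂₁ = 0 := by
    have hu : Sum.elim (0 : Fin q → ℂ) y ᵥ* X = Sum.elim (y ᵥ* X.toBlocks₂₁) 0 := by
      conv_lhs => rw [← fromBlocks_toBlocks X]
      simp [vecMul_fromBlocks, hy]
    have h0 : Sum.elim (0 : Fin q → ℂ) y ᵥ* X = 0 := by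
      refine hD.map_ofReal.vecMul_add_I_smul_eq_zero hR.map_ofReal ?_
      rw [← hX, hu]
      simp [dotProduct]
    funext j
    simpa using congrFun (hu.symm.trans h0) (Sum.inl j)
  obtain ⟨E, hE⟩ := X.toBlocks₂₂.exists_mul_eq_of_forall_vecMul_eq_zero (-X.toBlocks₂₁)
    fun y hy ↦ by rw [vecMul_neg, hker y hy, neg_zero]
  refine ⟨E, X.toBlocks₁₁ + X.toBlocks₁₂ * E, ?_⟩
  conv_lhs => rw [← fromBlocks_toBlocks X]
  simp [fromBlocks_multiply, hE]
end

section
/- Let D, R ∈ ℝ^{p×p} be symmetric positive semidefinite and suppose Γ₁, Γ₂ ∈ ℂ^{q×q} both satisfy the Schur-complement relation (D+jR)·[I_q; E_i] = [Γ_i; 0] for some E₁, E₂ ∈ ℂ^{(p−q)×q}. Then Γ₁ = Γ₂. -/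
open Matrix in
/-- Two Schur-complement relations of the same symmetric matrix have mutually transposed right-hand
sides. -/
theorem Matrix.IsSymm.eq_transpose_of_mul_fromBlocks {α m n k : Type*} [CommRing α]
    [Fintype m] [DecidableEq m] [Fintype n] {M : Matrix (m ⊕ n) (m ⊕ n) α} (hM : M.IsSymm)
    {E₁ E₂ : Matrix n m α} {Γ₁ Γ₂ : Matrix m m α}
    (h₁ : M * Matrix.fromBlocks 1 (0 : Matrix m k α) E₁ 0 = Matrix.fromBlocks Γ₁ 0 0 0)
    (h₂ : M * Matrix.fromBlocks 1 (0 : Matrix m k α) E₂ 0 = Matrix.fromBlocks Γ₂ 0 0 0) :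
    Γ₁ = Γ₂ᵀ := by
  have h := congrArg (fun X => (Matrix.fromBlocks 1 (0 : Matrix m k α) E₂ 0)ᵀ * X) h₁
  have h' := congrArg Matrix.transpose h₂
  rw [Matrix.transpose_mul, hM.eq] at h'
  simp only [← Matrix.mul_assoc, h'] at h
  simpa [Matrix.fromBlocks_transpose, fromBlocks_multiply, fromBlocks_inj, eq_comm] using h

open Matrix in
theorem schur_complement_unique
    (q r : ℕ)
    (D R : Matrix (Fin q ⊕ Fin r) (Fin q ⊕ Fin r) ℝ)
    (hD : D.PosSemidef) (hR : R.PosSemidef)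
    (E₁ E₂ : Matrix (Fin r) (Fin q) ℂ)
    (Γ₁ Γ₂ : Matrix (Fin q) (Fin q) ℂ)
    (h₁ : (D.map Complex.ofReal + Complex.I • R.map Complex.ofReal) *
          Matrix.fromBlocks 1 0 E₁ 0 = Matrix.fromBlocks Γ₁ 0 0 0)
    (h₂ : (D.map Complex.ofReal + Complex.I • R.map Complex.ofReal) *
          Matrix.fromBlocks 1 0 E₂ 0 = Matrix.fromBlocks Γ₂ 0 0 0) :
    Γ₁ = Γ₂ := by
  have hM : (D.map Complex.ofReal + Complex.I • R.map Complex.ofReal).IsSymm := by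
    have hD' : D.IsSymm := by simpa [IsHermitian, IsSymm] using hD.isHermitian
    have hR' : R.IsSymm := by simpa [IsHermitian, IsSymm] using hR.isHermitian
    exact (hD'.map _).add ((hR'.map _).smul _)
  exact (hM.eq_transpose_of_mul_fromBlocks h₁ h₂).trans
    (hM.eq_transpose_of_mul_fromBlocks h₂ h₂).symm
end

section
/- Let D, R ∈ ℝ^{p×p} be symmetric positive semidefinite and Γ = schur(D + jR, q). Then every eigenvalue λ of Γ satisfies Re λ ≥ 0 and Im λ ≥ 0. -/
open scoped ComplexOrder MatrixOrder Matrix.Norms.L2Operator in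
open Matrix in
theorem posSemidef_map_ofReal {n : Type*} [Fintype n] {A : Matrix n n ℝ} (hA : A.PosSemidef) :
    (A.map Complex.ofReal).PosSemidef := by
  classical
  obtain ⟨B, rfl⟩ := CStarAlgebra.nonneg_iff_eq_star_mul_self.mp hA.nonneg
  rw [star_eq_conjTranspose]
  have hB : (Bᴴ * B).map Complex.ofReal =
      (B.map Complex.ofReal)ᴴ * B.map Complex.ofReal := by
    ext i j
    simp [Matrix.mul_apply]
  rw [hB]
  exact Matrix.posSemidef_conjTranspose_mul_self _

open Matrix in
theorem schur_complement_eigenvalues_quadrant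
    (q r : ℕ)
    (D R : Matrix (Fin q ⊕ Fin r) (Fin q ⊕ Fin r) ℝ)
    (hD : D.PosSemidef) (hR : R.PosSemidef)
    (E : Matrix (Fin r) (Fin q) ℂ)
    (Γ : Matrix (Fin q) (Fin q) ℂ)
    (h : (D.map Complex.ofReal + Complex.I • R.map Complex.ofReal) *
          Matrix.fromBlocks 1 0 E 0 = Matrix.fromBlocks Γ 0 0 0)
    (lam : ℂ) (v : Fin q → ℂ) (hv : v ≠ 0)
    (heig : Γ.mulVec v = lam • v) :
    0 ≤ lam.re ∧ 0 ≤ lam.im := by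
  open scoped ComplexOrder in
  set w : Fin q ⊕ Fin r → ℂ := Sum.elim v (E *ᵥ v) with hw
  have hDw := (posSemidef_map_ofReal hD).dotProduct_mulVec_nonneg w
  have hRw := (posSemidef_map_ofReal hR).dotProduct_mulVec_nonneg w
  have hvv : 0 < star v ⬝ᵥ v := dotProduct_star_self_pos_iff.mpr hv
  have hmul : (D.map Complex.ofReal + Complex.I • R.map Complex.ofReal) *ᵥ w =
      Sum.elim (lam • v) 0 := by
    have := congrArg (· *ᵥ (Sum.elim v (0 : Fin r → ℂ))) h
    simpa [← mulVec_mulVec, fromBlocks_mulVec, heig] using this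
  have hform : star w ⬝ᵥ (D.map Complex.ofReal *ᵥ w) +
      Complex.I * (star w ⬝ᵥ (R.map Complex.ofReal *ᵥ w)) = lam * (star v ⬝ᵥ v) := by
    rw [← smul_eq_mul Complex.I, ← dotProduct_smul, ← smul_mulVec, ← dotProduct_add,
      ← add_mulVec, hmul]
    simp [hw, dotProduct, Fintype.sum_sum_type, Finset.mul_sum, mul_left_comm]
  generalize star w ⬝ᵥ (D.map Complex.ofReal *ᵥ w) = a at *
  generalize star w ⬝ᵥ (R.map Complex.ofReal *ᵥ w) = b at *
  generalize star v ⬝ᵥ v = s at *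
  rw [Complex.le_def] at hDw hRw
  rw [Complex.lt_def] at hvv
  have hre := congrArg Complex.re hform
  have him := congrArg Complex.im hform
  simp only [Complex.add_re, Complex.add_im, Complex.mul_re, Complex.mul_im, Complex.I_re,
    Complex.I_im, ← hDw.2, ← hRw.2, ← hvv.2, Complex.zero_re, Complex.zero_im] at *
  constructor
  · refine nonneg_of_mul_nonneg_left (b := s.re) ?_ hvv.1
    linarith
  · refine nonneg_of_mul_nonneg_left (b := s.re) ?_ hvv.1
    linarith
end

section
/- Let D, R ∈ ℝ^{p×p} be symmetric positive semidefinite Laplacians (so D𝟙_p = R𝟙_p = 0) and Γ = schur(D + jR, q). Then Γ·𝟙_q = 0; in particular 0 is an eigenvalue of Γ. -/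
namespace Matrix

variable {m n o α : Type*} [Fintype m] [Fintype n] [DecidableEq m] [CommRing α]

/-- A generalized Schur complement of a symmetric matrix is symmetric. -/
theorem isSymm_of_mul_fromBlocks_eq {Y : Matrix (m ⊕ n) (m ⊕ n) α} (hY : Y.IsSymm)
    {E : Matrix n m α} {Γ : Matrix m m α}
    (h : Y * (fromBlocks 1 0 E 0 : Matrix (m ⊕ n) (m ⊕ o) α) = fromBlocks Γ 0 0 0) :
    Γ.IsSymm := by
  have hM : (fromBlocks 1 0 E 0 : Matrix (m ⊕ n) (m ⊕ o) α)ᵀ *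
      (Y * (fromBlocks 1 0 E 0 : Matrix (m ⊕ n) (m ⊕ o) α)) = fromBlocks Γ 0 0 0 := by
    rw [h, fromBlocks_transpose, fromBlocks_multiply]
    simp
  have hT := congrArg transpose hM
  rw [transpose_mul, transpose_mul, transpose_transpose, hY.eq, Matrix.mul_assoc, hM,
    fromBlocks_transpose, fromBlocks_inj] at hT
  exact hT.1.symm

/-- If the rows of a symmetric matrix sum to zero, so do those of its generalized Schur
complement. -/
theorem mulVec_one_eq_zero_of_mul_fromBlocks_eq {Y : Matrix (m ⊕ n) (m ⊕ n) α}
    (hY : Y.IsSymm) (hY1 : Y *ᵥ 1 = 0) {E : Matrix n m α} {Γ : Matrix m m α}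
    (h : Y * (fromBlocks 1 0 E 0 : Matrix (m ⊕ n) (m ⊕ o) α) = fromBlocks Γ 0 0 0) :
    Γ *ᵥ 1 = 0 := by
  have hv : 1 ᵥ* (Y * (fromBlocks 1 0 E 0 : Matrix (m ⊕ n) (m ⊕ o) α)) = 0 := by
    rw [← vecMul_vecMul, ← mulVec_transpose Y, hY.eq, hY1, zero_vecMul]
  rw [h] at hv
  rw [← (isSymm_of_mul_fromBlocks_eq hY h).eq, mulVec_transpose]
  ext i
  simpa [vecMul, dotProduct] using congrFun hv (Sum.inl i)

end Matrix

open Matrix in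
theorem schur_complement_ones_kernel
    (q r : ℕ) (hq : 0 < q)
    (D R : Matrix (Fin q ⊕ Fin r) (Fin q ⊕ Fin r) ℝ)
    (hD : D.PosSemidef) (hR : R.PosSemidef)
    (hD1 : D.mulVec (fun _ => 1) = 0) (hR1 : R.mulVec (fun _ => 1) = 0)
    (E : Matrix (Fin r) (Fin q) ℂ)
    (Γ : Matrix (Fin q) (Fin q) ℂ)
    (h : (D.map Complex.ofReal + Complex.I • R.map Complex.ofReal) *
          Matrix.fromBlocks 1 0 E 0 = Matrix.fromBlocks Γ 0 0 0) :
    Γ.mulVec (fun _ => 1) = 0 ∧ ∃ v : Fin q → ℂ, v ≠ 0 ∧ Γ.mulVec v = 0 := by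
  have hsymm {A : Matrix (Fin q ⊕ Fin r) (Fin q ⊕ Fin r) ℝ} (hA : A.PosSemidef) :
      (A.map Complex.ofReal).IsSymm := by
    have hA' : A.IsSymm := by simpa [IsHermitian, IsSymm] using hA.isHermitian
    exact hA'.map _
  have hones {A : Matrix (Fin q ⊕ Fin r) (Fin q ⊕ Fin r) ℝ} (hA : A.mulVec (fun _ => 1) = 0) :
      A.map Complex.ofReal *ᵥ 1 = 0 := by
    ext i
    simpa [mulVec, dotProduct] using congrArg Complex.ofReal (congrFun hA i)
  have hΓ : Γ.mulVec (fun _ => 1) = 0 :=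
    mulVec_one_eq_zero_of_mul_fromBlocks_eq ((hsymm hD).add ((hsymm hR).smul _))
      (by rw [add_mulVec, smul_mulVec, hones hD1, hones hR1, smul_zero, add_zero]) h
  exact ⟨hΓ, fun _ => 1, fun hv => one_ne_zero (congrFun hv ⟨0, hq⟩), hΓ⟩
end
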